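/- Fix an integer p ≥ 2 and suppose the complex numbers z₁, …, z_{2p−1} satisfy the gluing system. Then Re(z_i) ≠ 1 for every i with 1 ≤ i ≤ 2p−1. -/

import Mathlib

/-- The gluing system for the `p`-th twist knot: `z 1, …, z (2p-1)` are complex numbers,
none of which is a nonnegative real number, satisfying the critical-point equations of
the potential function `f`. -/
def GluingSystem (p : ℕ) (z : ℕ → ℂ) : Prop :=
  (∀ i : ℕ, 1 ≤ i → i ≤ 2 * p - 1 → ¬ ∃ r : ℝ, 0 ≤ r ∧ z i = (r : ℂ)) ∧
  (1 - z 1 / z 2 = (1 - z 1) * (1 - 1 / z 1)) ∧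
  (∀ i : ℕ, 2 ≤ i → i ≤ 2 * p - 2 →
    (1 - z i / z (i + 1)) * (1 - 1 / z i) = (1 - z i) * (1 - z (i - 1) / z i)) ∧
  (1 - 1 / z (2 * p - 1) = (1 - z (2 * p - 1)) * (1 - z (2 * p - 2) / z (2 * p - 1)))

open Polynomial
open scoped NumberField Pointwise
open NumberField
noncomputable def seqE : ℕ → ℤ[X]
  | 0 => 0
  | 1 => 1
  | (k+2) => seqE k - X * seqE (k+1)

noncomputable def seqG : ℕ → ℤ[X]
  | 0 => 1
  | 1 => 1
  | (k+2) => seqG k - X * seqG (k+1)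

lemma seqE_add_two (k : ℕ) : seqE (k+2) = seqE k - X * seqE (k+1) := by rw [seqE]
lemma seqG_add_two (k : ℕ) : seqG (k+2) = seqG k - X * seqG (k+1) := by rw [seqG]

lemma seqG_eq (k : ℕ) : seqG (k+1) = seqE (k+1) + seqE k ∧ seqG (k+2) = seqE (k+2) + seqE (k+1) := by
  induction k with
  | zero => simp [seqG, seqE]; ring
  | succ k ih =>
    refine ⟨ih.2, ?_⟩
    have := seqG_add_two (k+1)
    rw [show k+1+2 = k+3 from rfl, show k+1+1 = k+2 from rfl] at this ⊢
    have h1 := seqE_add_two (k+1)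
    have h2 := seqE_add_two k
    rw [show k+1+2 = k+3 from rfl, show k+1+1 = k+2 from rfl] at h1
    linear_combination this + ih.1 - X * ih.2 - h1 - h2

lemma cassini (m : ℕ) : seqE (m+1)^2 + X * seqE m * seqE (m+1) - seqE m^2 = (-1)^m := by
  induction m with
  | zero => simp [seqE]
  | succ k ih =>
    rw [show k+1+1 = k+2 from rfl]
    have h := seqE_add_two k
    linear_combination (-1) * ih + (seqE (k+2) + seqE k - X * seqE (k+1) + X * seqE (k+1)) * h

lemma seqE_deriv (m : ℕ) :
    (X^2+4) * derivative (seqE m) = -2 * (m:ℤ[X]) * seqE (m+1) - ((m:ℤ[X])+1) * X * seqE m ∧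
    (X^2+4) * derivative (seqE (m+1)) = -2 * ((m:ℤ[X])+1) * seqE (m+2) - ((m:ℤ[X])+2) * X * seqE (m+1) := by
  induction m with
  | zero => constructor <;> simp [seqE]
  | succ k ih =>
    refine ⟨?_, ?_⟩
    · rw [ih.2]; push_cast; ring
    · rw [show k+1+2 = k+3 from rfl, show k+1+1 = k+2 from rfl]
      have h1 := seqE_add_two (k+1)
      have h2 := seqE_add_two k
      rw [show k+1+2 = k+3 from rfl, show k+1+1 = k+2 from rfl] at h1
      have h3 : derivative (seqE (k+2)) = derivative (seqE k) - seqE (k+1) - X * derivative (seqE (k+1)) := by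
        rw [h2]; simp; ring
      push_cast
      rw [h3]
      linear_combination ih.1 - X * ih.2 + (-2 * (k:ℤ[X]) - 4) * (-h1) + (-((k:ℤ[X])+1) * X) * (-h2)

lemma seqG_deriv (m : ℕ) :
    (X^2+4) * derivative (seqG (m+1)) = - seqE m * ((2*m+1 : ℤ[X]) * X + 2) + (m:ℤ[X]) * (X - 2) * seqG (m+1) := by
  rw [(seqG_eq m).1, derivative_add]
  have := seqE_deriv m
  linear_combination this.1 + this.2 - 2*((m:ℤ[X])+1)*seqE_add_two m

lemma seqG_monic_aux (k : ℕ) : ((-1)^k * seqG (k+1)).degree = k ∧ ((-1)^k * seqG (k+1)).Monic ∧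
    ((-1)^(k+1) * seqG (k+2)).degree = (k+1 : ℕ) ∧ ((-1)^(k+1) * seqG (k+2)).Monic := by
  induction k with
  | zero =>
    have : (-1)^(0+1) * seqG (0+2) = X - C 1 := by simp [seqG]
    rw [this]
    refine ⟨by simp [seqG], by simp [seqG], by rw [degree_X_sub_C]; rfl, monic_X_sub_C 1⟩
  | succ k ih =>
    obtain ⟨h1, h2, h3, h4⟩ := ih
    refine ⟨h3, h4, ?_⟩
    have e : (-1)^(k+1+1) * seqG (k+1+2) = (-1)^k * seqG (k+1) + X * ((-1)^(k+1) * seqG (k+2)) := by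
      rw [seqG_add_two (k+1)]; ring
    have hd : (X * ((-1)^(k+1) * seqG (k+2))).degree = ((k+2 : ℕ) : WithBot ℕ) := by
      rw [degree_mul, h3, degree_X]; push_cast; ring
    have hlt : ((-1)^k * seqG (k+1)).degree < (X * ((-1)^(k+1) * seqG (k+2))).degree := by
      rw [h1, hd]; exact_mod_cast (by omega : k < k+2)
    rw [e]
    exact ⟨by rw [degree_add_eq_right_of_degree_lt hlt, hd], (monic_X.mul h4).add_of_right hlt⟩

lemma seqG_monic (m : ℕ) (hm : Even m) : (seqG (m+1)).Monic := by
  have := (seqG_monic_aux m).2.1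
  rwa [hm.neg_one_pow, one_mul] at this

lemma seqG_coeff_zero (k : ℕ) : (seqG k).coeff 0 = 1 ∧ (seqG (k+1)).coeff 0 = 1 := by
  induction k with
  | zero => simp [seqG]
  | succ k ih => refine ⟨ih.2, ?_⟩; rw [show k+1+1 = k+2 from rfl, seqG_add_two]; simp [ih.1]

section fld
variable {K : Type*} [Field K]

lemma E_root_ne (m : ℕ) (a : K) (h : (seqG (m+1)).eval₂ (Int.castRingHom K) a = 0) :
    (seqE m).eval₂ (Int.castRingHom K) a ≠ 0 := by
  intro h0
  rw [(seqG_eq m).1, eval₂_add, h0, add_zero] at h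
  have := congrArg (eval₂ (Int.castRingHom K) a) (cassini m)
  simp only [eval₂_sub, eval₂_add, eval₂_mul, eval₂_pow, h, h0, eval₂_neg, eval₂_one] at this
  simp only [mul_zero, add_zero, sub_self, ne_eq, OfNat.ofNat_ne_zero, not_false_eq_true, zero_pow] at this
  exact absurd this.symm (pow_ne_zero _ (neg_ne_zero.mpr one_ne_zero))

lemma N_ne (m : ℕ) (hm : Even m) (a : K) (h2 : (2 * (m:K) + 1) * a + 2 = 0) : (2 * (m:K) + 1) ≠ 0 := by
  intro h
  obtain ⟨n, rfl⟩ := hm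
  rw [h, zero_mul, zero_add] at h2
  push_cast at h
  have : (1:K) = 0 := by linear_combination h - 2 * (n:K) * h2
  exact one_ne_zero this

lemma map_deriv (m : ℕ) :
    (X^2+4) * derivative ((seqG (m+1)).map (Int.castRingHom K)) = - ((seqE m).map (Int.castRingHom K)) * ((2*m+1 : K[X]) * X + 2) + (m:K[X]) * (X - 2) * (seqG (m+1)).map (Int.castRingHom K) := by
  have := congrArg (Polynomial.map (Int.castRingHom K)) (seqG_deriv m)
  simpa [derivative_map] using this

lemma double_root (m : ℕ) (a : K) (h : (X - C a)^2 ∣ (seqG (m+1)).map (Int.castRingHom K)) :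
    (2 * (m:K) + 1) * a + 2 = 0 := by
  have hr : ((seqG (m+1)).map (Int.castRingHom K)).eval a = 0 :=
    dvd_iff_isRoot.mp ((dvd_pow_self _ two_ne_zero).trans h)
  have hd : (derivative ((seqG (m+1)).map (Int.castRingHom K))).eval a = 0 := by
    obtain ⟨q, hq⟩ := h
    rw [hq]; simp [derivative_mul, derivative_pow]
  have := congrArg (eval a) (map_deriv (K := K) m)
  have hE := E_root_ne m a (by rwa [eval_map] at hr)
  rw [← eval_map] at hE
  simp only [eval_mul, eval_add, eval_neg, hr, hd, mul_zero, add_zero] at this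
  have h3 := (mul_eq_zero.mp this.symm).resolve_left (by simpa using hE)
  simpa using h3

lemma double_unique (m : ℕ) (hm : Even m) (a b : K) (h : (X - C a)^2 ∣ (seqG (m+1)).map (Int.castRingHom K))
    (h' : (X - C b)^2 ∣ (seqG (m+1)).map (Int.castRingHom K)) : a = b := by
  have h1 := double_root m a h
  have h2 := double_root m b h'
  exact mul_left_cancel₀ (N_ne m hm a h1) (by linear_combination h1 - h2)

lemma no_triple (m : ℕ) (hm : Even m) (a : K) : ¬ (X - C a)^3 ∣ (seqG (m+1)).map (Int.castRingHom K) := by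
  intro h
  have h2 : (X - C a)^2 ∣ (seqG (m+1)).map (Int.castRingHom K) := (pow_dvd_pow _ (by norm_num)).trans h
  have hN := N_ne m hm a (double_root m a h2)
  have hr : ((seqG (m+1)).map (Int.castRingHom K)).eval a = 0 :=
    dvd_iff_isRoot.mp ((dvd_pow_self _ two_ne_zero).trans h2)
  have hE := E_root_ne m a (by rwa [eval_map] at hr)
  rw [← eval_map] at hE
  have hd : (X - C a)^2 ∣ derivative ((seqG (m+1)).map (Int.castRingHom K)) := by
    obtain ⟨q, hq⟩ := h
    rw [hq]
    refine ⟨3 * q + (X - C a) * derivative q, ?_⟩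
    have h3 : (C 3 : K[X]) = 3 := rfl
    simp [derivative_mul, derivative_pow, h3]; ring
  have hdd : (X - C a)^2 ∣ ((seqE m).map (Int.castRingHom K)) * ((2*m+1 : K[X]) * X + 2) := by
    have e : ((seqE m).map (Int.castRingHom K)) * ((2*m+1 : K[X]) * X + 2) = 
      (m:K[X]) * (X - 2) * (seqG (m+1)).map (Int.castRingHom K) - (X^2+4) * derivative ((seqG (m+1)).map (Int.castRingHom K)) := by
      linear_combination map_deriv (K := K) m
    rw [e]
    exact dvd_sub (h2.mul_left _) (hd.mul_left _)
  have hcop : IsCoprime ((X - C a)^2) ((seqE m).map (Int.castRingHom K)) := by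
    apply IsCoprime.pow_left
    rw [(irreducible_X_sub_C a).coprime_iff_not_dvd, dvd_iff_isRoot]
    exact hE
  have h5 := hcop.dvd_of_dvd_mul_left hdd
  have e : ((2*m+1 : K[X]) * X + 2) = C (2*(m:K)+1) * X + C 2 := by
    have h2 : (C 2 : K[X]) = 2 := rfl
    simp [h2]
  rw [e] at h5
  have h6 := natDegree_le_of_dvd h5 (by
    intro h0
    have := congrArg (coeff · 1) h0
    simp at this
    exact hN (by simpa using this))
  rw [natDegree_pow, natDegree_X_sub_C] at h6
  have := natDegree_linear_le (a := 2*(m:K)+1) (b := 2)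
  omega

lemma card_le_toFinset {α : Type*} [DecidableEq α] (s : Multiset α) (h2 : ∀ a, s.count a ≤ 2)
    (hu : ∀ a b, 2 ≤ s.count a → 2 ≤ s.count b → a = b) : s.card ≤ s.toFinset.card + 1 := by
  rw [← Multiset.toFinset_sum_count_eq]
  by_cases hx : ∃ x0, 2 ≤ s.count x0
  · obtain ⟨x0, hx0⟩ := hx
    calc ∑ a ∈ s.toFinset, s.count a ≤ ∑ a ∈ s.toFinset, (1 + if a = x0 then 1 else 0) := by
          apply Finset.sum_le_sum
          intro a _
          split_ifs with h
          · exact h2 a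
          · by_contra hc
            exact h (hu a x0 (by omega) hx0)
      _ ≤ _ := by
          rw [Finset.sum_add_distrib, Finset.sum_ite_eq']
          simp only [Finset.sum_const, smul_eq_mul, mul_one]
          split_ifs <;> omega
  · push Not at hx
    calc ∑ a ∈ s.toFinset, s.count a ≤ ∑ a ∈ s.toFinset, 1 :=
          Finset.sum_le_sum fun a _ => by have := hx a; omega
      _ ≤ _ := by simp

lemma morse_field (m : ℕ) (hm : Even m) (f : ℤ[X]) (hf : f ∣ seqG (m+1)) (hmon : f.Monic)
    [Algebra ℤ K] (hs : (f.map (algebraMap ℤ K)).Splits) :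
    f.natDegree ≤ (f.rootSet K).ncard + 1 := by
  classical
  have hZ : algebraMap ℤ K = Int.castRingHom K := RingHom.ext_int _ _
  have hne : (seqG (m+1)).map (Int.castRingHom K) ≠ 0 := ((seqG_monic m hm).map _).ne_zero
  have hd : f.map (algebraMap ℤ K) ∣ (seqG (m+1)).map (Int.castRingHom K) := by
    rw [hZ]; exact Polynomial.map_dvd _ hf
  have hfne : f.map (algebraMap ℤ K) ≠ 0 := (hmon.map _).ne_zero
  have hpow : ∀ a n, n ≤ (f.aroots K).count a → (X - C a)^n ∣ (seqG (m+1)).map (Int.castRingHom K) := by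
    intro a n h
    rw [aroots_def, count_roots] at h
    exact ((le_rootMultiplicity_iff hfne).mp h).trans hd
  rw [← hmon.natDegree_map (algebraMap ℤ K), hs.natDegree_eq_card_roots, rootSet_def, Set.ncard_coe_finset]
  apply card_le_toFinset
  · intro a
    by_contra hc
    exact no_triple m hm a (hpow a 3 (by rw [aroots_def]; omega))
  · intro a b ha hb
    exact double_unique m hm a b (hpow a 2 ha) (hpow b 2 hb)
end fld

lemma iSup_inertia_top (L : Type) [Field L] [NumberField L] [IsGalois ℚ L] :
    ⨆ m : MaximalSpectrum (𝓞 L), m.asIdeal.inertia Gal(L/ℚ) = ⊤ := by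
  set H : Subgroup Gal(L/ℚ) := ⨆ m : MaximalSpectrum (𝓞 L), m.asIdeal.inertia Gal(L/ℚ) with hH
  let F := IntermediateField.fixedField H
  have hFH : F.fixingSubgroup = H := IntermediateField.fixingSubgroup_fixedField H
  have : NumberField F := inferInstance
  have iG : IsGaloisGroup Gal(L/ℚ) ℤ (𝓞 L) := IsGaloisGroup.of_isFractionRing Gal(L/ℚ) ℤ (𝓞 L) ℚ L
  have iH0 : IsGaloisGroup H F L := IsGaloisGroup.subgroup Gal(L/ℚ) ℚ L H
  have iH : IsGaloisGroup H (𝓞 F) (𝓞 L) := IsGaloisGroup.of_isFractionRing H (𝓞 F) (𝓞 L) F L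
  have hF1 : Module.finrank ℚ F = 1 := by
    by_contra hne
    obtain ⟨P, hP, hun⟩ := NumberField.exists_not_isUnramifiedAt_int (𝒪 := 𝓞 F) hne
    apply hun
    rw [← Ideal.ramificationIdx_eq_one_iff]
    obtain ⟨Q, hQ, hQP⟩ : ∃ Q : Ideal (𝓞 L), Q.IsMaximal ∧ Q.LiesOver P := by
      exact Ideal.exists_maximal_ideal_liesOver_of_isIntegral P
    have hQ0 : Q ≠ ⊥ := Ideal.IsMaximal.ne_bot_of_isIntegral_int _
    have hP0 : P ≠ ⊥ := Ideal.IsMaximal.ne_bot_of_isIntegral_int _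
    have hle : Q.inertia Gal(L/ℚ) ≤ H := le_iSup (fun m : MaximalSpectrum (𝓞 L) => m.asIdeal.inertia Gal(L/ℚ)) ⟨Q, hQ⟩
    have : (Q.under ℤ) ≠ ⊥ := fun h => hQ0 (Ideal.eq_bot_of_comap_eq_bot h)
    have : (Q.under ℤ).IsMaximal := Ideal.IsMaximal.under ℤ Q
    have h1 : Nat.card (Q.inertia Gal(L/ℚ)) = Q.ramificationIdx ℤ := by
      rw [← Ideal.ramificationIdxIn_eq_ramificationIdx (Q.under ℤ) Q Gal(L/ℚ)]
      have : Finite (ℤ ⧸ Q.under ℤ) := Ring.HasFiniteQuotients.finiteQuotient ‹_›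
      exact Ideal.card_inertia_eq_ramificationIdxIn (Q.under ℤ)  Q
    have h2 : Nat.card (Q.inertia H) = Q.ramificationIdx (𝓞 F) := by
      rw [← Ideal.ramificationIdxIn_eq_ramificationIdx P Q H]
      have : Finite (𝓞 F ⧸ P) := Ring.HasFiniteQuotients.finiteQuotient ‹_›
      exact Ideal.card_inertia_eq_ramificationIdxIn P Q
    have h3 : Nat.card (Q.inertia H) = Nat.card (Q.inertia Gal(L/ℚ)) := by
      have : Q.inertia H = (Q.inertia Gal(L/ℚ)).subgroupOf H := by
        ext x; rfl
      rw [this]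
      exact Nat.card_congr (Subgroup.subgroupOfEquivOfLe hle).toEquiv
    have h4 := Ideal.ramificationIdx_tower (R := ℤ) P Q
    rw [← h1, ← h2, ← h3] at h4
    have : 0 < Nat.card (Q.inertia H) := Nat.card_pos
    nlinarith
  rw [← hFH]
  have : F = ⊥ := IntermediateField.finrank_eq_one_iff.mp hF1
  rw [this, IntermediateField.fixingSubgroup_bot]

lemma hom_aeval {A B : Type*} [CommRing A] [CommRing B] (ψ : A →+* B) (x : A) (f : ℤ[X]) :
    ψ (aeval x f) = aeval (ψ x) f :=
  (Polynomial.aeval_algHom_apply ψ.toIntAlgHom x f).symm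

lemma exists_splitting (f : ℚ[X]) : ∃ (L : Type) (_ : Field L) (_ : NumberField L), IsSplittingField ℚ L f := by
  have key : ∀ (L : Type) [Field L] (i : Algebra ℚ L) (_ : IsSplittingField ℚ L f),
      ∃ (L : Type) (_ : Field L) (_ : NumberField L), IsSplittingField ℚ L f := by
    intro L _ i hi
    have : CharZero L := algebraRat.charZero L
    obtain rfl : i = DivisionRing.toRatAlgebra := Subsingleton.elim _ _
    have : FiniteDimensional ℚ L := IsSplittingField.finiteDimensional L f
    exact ⟨L, inferInstance, { to_charZero := inferInstance, to_finiteDimensional := inferInstance }, hi⟩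
  exact key f.SplittingField _ (IsSplittingField.splittingField f)

lemma galois_key (m : ℕ) (hm : Even m) (f : ℤ[X]) (hf : f ∣ seqG (m+1)) (hmon : f.Monic)
    (hirr : Irreducible f) (a b c : ℂ) (ha : aeval a f = 0) (hb : aeval b f = 0) (hc : aeval c f = 0)
    (hab : a ≠ b) (hac : a ≠ c) (hbc : b ≠ c) :
    ∃ (L : Type) (_ : Field L) (α β : L) (φ σ τ : L →+* ℂ), φ α = a ∧ φ β = b ∧ σ α = a ∧ σ β = c ∧
      τ α = c ∧ τ β = b := by
  let fQ : ℚ[X] := f.map (algebraMap ℤ ℚ)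
  have hfQm : fQ.Monic := hmon.map _
  have hfQ : Irreducible fQ := (hmon.irreducible_iff_irreducible_map_fraction_map).mp hirr
  obtain ⟨L, _, _, hsp⟩ := exists_splitting fQ
  have : IsGalois ℚ L := IsGalois.of_separable_splitting_field (p := fQ) hfQ.separable
  have hLs : (fQ.map (algebraMap ℚ L)).Splits := IsSplittingField.splits L fQ
  have hmapL : fQ.map (algebraMap ℚ L) = f.map (algebraMap ℤ L) := by
    rw [Polynomial.map_map]; congr 1; exact RingHom.ext_int _ _
  rw [hmapL] at hLs
  have hLO : (f.map (algebraMap ℤ (𝓞 L))).map (algebraMap (𝓞 L) L) = f.map (algebraMap ℤ L) := by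
    rw [Polynomial.map_map]; congr 1
  have hinj : Function.Injective (algebraMap (𝓞 L) L) := RingOfIntegers.coe_injective
  have hlift : ∀ x : L, aeval x f = 0 → ∃ y : 𝓞 L, (y : L) = x := fun x hx =>
    ⟨⟨x, ⟨f, hmon, hx⟩⟩, rfl⟩
  have hOs : (f.map (algebraMap ℤ (𝓞 L))).Splits := by
    apply Splits.of_splits_map_of_injective (i := algebraMap (𝓞 L) L) hinj
    · rwa [hLO]
    · rw [hLO]
      intro x hx
      rw [mem_roots', IsRoot.def, eval_map_algebraMap] at hx
      exact hlift x hx.2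
  let φ : L →ₐ[ℚ] ℂ := IsAlgClosed.lift
  have hmem : ∀ y : 𝓞 L, y ∈ f.rootSet (𝓞 L) ↔ aeval (y : L) f = 0 := by
    intro y
    rw [mem_rootSet', and_iff_right (hmon.map _).ne_zero]
    have : aeval (y : L) f = ((aeval y f : 𝓞 L) : L) := aeval_algebraMap_apply L y f
    rw [this]
    exact ⟨fun h => by rw [h]; rfl, fun h => hinj (by rw [map_zero]; exact h)⟩
  have hroot : ∀ x : ℂ, aeval x f = 0 → ∃ y : f.rootSet (𝓞 L), φ ((y : 𝓞 L) : L) = x := by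
    intro x hx
    obtain ⟨w, rfl⟩ := hLs.mem_range_of_isRoot (i := (φ : L →+* ℂ)) (x := x) (hmon.map _).ne_zero (by
      rw [Polynomial.map_map, IsRoot.def, eval_map, ← hx, aeval_def]; congr 1; exact RingHom.ext_int _ _) 
    have hw : aeval w f = 0 := by
      apply (φ : L →+* ℂ).injective
      rw [map_zero, ← hx]
      exact hom_aeval (φ : L →+* ℂ) w f
    obtain ⟨y, rfl⟩ := hlift w hw
    exact ⟨⟨y, (hmem y).mpr hw⟩, rfl⟩
  have hmin : ∀ x : L, aeval x f = 0 → minpoly ℚ x = fQ := by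
    intro x hx
    refine (minpoly.eq_of_irreducible_of_monic hfQ ?_ hfQm).symm
    rw [aeval_map_algebraMap]; exact hx
  have htrans : MulAction.IsPretransitive Gal(L/ℚ) (f.rootSet (𝓞 L)) := by
    refine ⟨fun x y => ?_⟩
    have : IsConjRoot ℚ ((y : 𝓞 L) : L) ((x : 𝓞 L) : L) := by
      rw [IsConjRoot, hmin _ ((hmem _).mp x.2), hmin _ ((hmem _).mp y.2)]
    obtain ⟨σ, hσ⟩ := this.exists_algEquiv
    exact ⟨σ, Subtype.ext (hinj hσ)⟩
  have hsurj := hOs.surjective_toPermHom_of_iSup_inertia_eq_top (G := Gal(L/ℚ)) (f := f) (S := 𝓞 L) ?_ (iSup_inertia_top L)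
  · obtain ⟨α, rfl⟩ := hroot a ha
    obtain ⟨β, rfl⟩ := hroot b hb
    obtain ⟨γ, rfl⟩ := hroot c hc
    classical
    obtain ⟨s, hs⟩ := hsurj (Equiv.swap β γ)
    obtain ⟨t, ht⟩ := hsurj (Equiv.swap α γ)
    have act : ∀ (u : Gal(L/ℚ)) (x : f.rootSet (𝓞 L)), u ((x : 𝓞 L) : L) = (((MulAction.toPermHom Gal(L/ℚ) (f.rootSet (𝓞 L)) u x : f.rootSet (𝓞 L)) : 𝓞 L) : L) := by
      intro u x; rfl
    have n1 : α ≠ β := fun h => hab (by rw [h])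
    have n2 : α ≠ γ := fun h => hac (by rw [h])
    have n3 : β ≠ γ := fun h => hbc (by rw [h])
    refine ⟨L, inferInstance, ((α : 𝓞 L) : L), ((β : 𝓞 L) : L), φ, (φ : L →+* ℂ).comp (s : L →+* L), (φ : L →+* ℂ).comp (t : L →+* L), rfl, rfl, ?_, ?_, ?_, ?_⟩
    · simp [act, hs, Equiv.swap_apply_of_ne_of_ne n1 n2]
    · simp [act, hs]
    · simp [act, ht]
    · simp [act, ht, Equiv.swap_apply_of_ne_of_ne n1.symm n3]
  · intro M
    have hM := M.isMaximal
    let _ : Field (𝓞 L ⧸ M.asIdeal) := Ideal.Quotient.field M.asIdeal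
    have h1 : (f.rootSet (𝓞 L)).ncard ≤ f.natDegree := by
      classical
      rw [rootSet_def, Set.ncard_coe_finset]
      exact (Multiset.toFinset_card_le _).trans ((card_roots' _).trans natDegree_map_le)
    refine h1.trans ?_
    have := morse_field (K := 𝓞 L ⧸ M.asIdeal) m hm f hf hmon (by
      have := hOs.map (algebraMap (𝓞 L) (𝓞 L ⧸ M.asIdeal))
      rw [Polynomial.map_map] at this
      rw [show (algebraMap (𝓞 L) (𝓞 L ⧸ M.asIdeal)).comp (algebraMap ℤ (𝓞 L)) =
        algebraMap ℤ (𝓞 L ⧸ M.asIdeal) from RingHom.ext_int _ _] at this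
      exact this)
    exact this

lemma aeval_G (s : ℂ) (k : ℕ) :
    aeval s (seqG (k+2)) = aeval s (seqG k) - s * aeval s (seqG (k+1)) := by
  rw [seqG_add_two]; simp

lemma re_step (s x y : ℂ) : ((x - s * y) * (starRingEnd ℂ) y).re =
    (y * (starRingEnd ℂ) x).re - s.re * Complex.normSq y := by
  simp [Complex.normSq_apply]; ring

lemma re_pos_of_root (s : ℂ) (k : ℕ) (h : aeval s (seqG (k+1)) = 0) : 0 < s.re := by
  by_contra hs
  push Not at hs
  have key : ∀ j, 1 ≤ (aeval s (seqG (j+1)) * (starRingEnd ℂ) (aeval s (seqG j))).re := by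
    intro j
    induction j with
    | zero => simp [seqG]
    | succ j ih =>
      rw [aeval_G, re_step]
      nlinarith [Complex.normSq_nonneg (aeval s (seqG (j+1)))]
  have := key k
  rw [h] at this
  norm_num at this

lemma special_root (s : ℂ) (h : s^2 - s + 1 = 0) (hre : 0 < s.re) (k : ℕ) :
    aeval s (seqG (k+5)) ≠ 0 := by
  have hre2 : s.re < 1 := by
    have h1 := congrArg Complex.re h
    have h2 := congrArg Complex.im h
    simp [pow_two] at h1 h2
    have h3 : s.im * (2 * s.re - 1) = 0 := by linear_combination h2
    rcases mul_eq_zero.mp h3 with h4 | h4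
    · rw [h4] at h1; nlinarith [sq_nonneg (s.re - 1/2)]
    · linarith
  have key : ∀ j, (aeval s (seqG (j+5)) * (starRingEnd ℂ) (aeval s (seqG (j+4)))).re < 0 := by
    intro j
    induction j with
    | zero =>
      have e2 : aeval s (seqG 2) = 1 - s := by rw [aeval_G s 0]; simp [seqG]
      have e3 : aeval s (seqG 3) = 0 := by
        rw [aeval_G s 1, e2]; simp [seqG]; linear_combination h
      have e4 : aeval s (seqG 4) = 1 - s := by rw [aeval_G s 2, e2, e3]; ring
      have e5 : aeval s (seqG 5) = -1 := by rw [aeval_G s 3, e3, e4]; linear_combination h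
      rw [zero_add, zero_add, e4, e5]; simp; linarith
    | succ j ih =>
      rw [show j+1+5 = j+4+2 from rfl, aeval_G, show j+4+1 = j+5 from rfl, show j+1+4 = j+5 from rfl, re_step]
      nlinarith [Complex.normSq_nonneg (aeval s (seqG (j+5)))]
  intro h0
  have := key k
  rw [h0] at this
  simp at this

lemma main_arith (m : ℕ) (hm : Even m) (hm4 : 4 ≤ m) (s : ℂ) (him : s.im ≠ 0)
    (hr : aeval s (seqG (m+1)) = 0) (i : ℕ) (h1 : aeval s (seqG i) ≠ 0) (h2 : aeval s (seqG (i+1)) ≠ 0)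
    (hrel : s * aeval s (seqG i) * (starRingEnd ℂ) (aeval s (seqG (i+1))) +
      (starRingEnd ℂ) (s * aeval s (seqG i)) * aeval s (seqG (i+1)) = 0) : False := by
  have hint : IsIntegral ℤ s := ⟨seqG (m+1), seqG_monic m hm, hr⟩
  set f := minpoly ℤ s with hfdef
  have hmon : f.Monic := minpoly.monic hint
  have hirr : Irreducible f := minpoly.irreducible hint
  have hfs : aeval s f = 0 := minpoly.aeval ℤ s
  have hdvd : f ∣ seqG (m+1) := minpoly.isIntegrallyClosed_dvd hint hr
  have hs0 : s ≠ 0 := by rintro rfl; simp at him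
  have hconj : ∀ g : ℤ[X], aeval ((starRingEnd ℂ) s) g = (starRingEnd ℂ) (aeval s g) := fun g =>
    (hom_aeval (starRingEnd ℂ) s g).symm
  have hsne : s ≠ (starRingEnd ℂ) s := by
    intro h
    exact him (Complex.conj_eq_iff_im.mp h.symm)
  have hfsc : aeval ((starRingEnd ℂ) s) f = 0 := by rw [hconj, hfs, map_zero]
  by_cases hc : ∃ c : ℂ, aeval c f = 0 ∧ s ≠ c ∧ (starRingEnd ℂ) s ≠ c
  · obtain ⟨c, hfc, hsc, hsc'⟩ := hc
    obtain ⟨L, _, α, β, φ, σ, τ, e1, e2, e3, e4, e5, e6⟩ :=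
      galois_key m hm f hdvd hmon hirr s ((starRingEnd ℂ) s) c hfs hfsc hfc hsne hsc hsc'
    let h : L := α * aeval α (seqG i) * aeval β (seqG (i+1)) + β * aeval β (seqG i) * aeval α (seqG (i+1))
    have hh : h = 0 := by
      apply φ.injective
      simp only [h, map_add, map_mul, hom_aeval, e1, e2, map_zero]
      rw [hconj, hconj]
      rw [map_mul] at hrel
      exact hrel
    have q1 := congrArg φ hh
    have q2 := congrArg σ hh
    have q3 := congrArg τ hh
    simp only [h, map_add, map_mul, hom_aeval, map_zero, e1, e2, e3, e4, e5, e6] at q1 q2 q3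
    have nb : aeval ((starRingEnd ℂ) s) (seqG (i+1)) ≠ 0 := by
      rw [hconj]; simpa using h2
    have nc : aeval c (seqG (i+1)) ≠ 0 := by
      intro h0
      rw [← e4, ← hom_aeval, map_eq_zero] at h0
      apply nb
      rw [← e2, ← hom_aeval, h0, map_zero]
    have : 2 * s * aeval s (seqG i) * aeval ((starRingEnd ℂ) s) (seqG (i+1)) * aeval c (seqG (i+1)) = 0 := by
      linear_combination aeval c (seqG (i+1)) * q1 + aeval ((starRingEnd ℂ) s) (seqG (i+1)) * q2 - aeval s (seqG (i+1)) * q3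
    simp [hs0, h1, nb, nc] at this
  · push Not at hc
    have hcard : f.natDegree ≤ 2 := by
      classical
      have hQ : Irreducible (f.map (algebraMap ℤ ℚ)) := (hmon.irreducible_iff_irreducible_map_fraction_map).mp hirr
      have hcr := card_rootSet_eq_natDegree (K := ℂ) hQ.separable (IsAlgClosed.splits _)
      rw [hmon.natDegree_map] at hcr
      rw [← hcr, ← Set.toFinset_card]
      refine (Finset.card_le_card (t := {s, (starRingEnd ℂ) s}) ?_).trans Finset.card_le_two
      intro x hx
      rw [Set.mem_toFinset, mem_rootSet', aeval_map_algebraMap] at hx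
      have := hc x hx.2
      simp only [Finset.mem_insert, Finset.mem_singleton]
      by_cases hxs : s = x
      · exact Or.inl hxs.symm
      · exact Or.inr (this hxs).symm
    have hpos := re_pos_of_root s m hr
    have hb : f.coeff 0 ∣ 1 := by
      obtain ⟨q, hq⟩ := hdvd
      have := congrArg (coeff · 0) hq
      simp only [mul_coeff_zero, (seqG_coeff_zero m).2] at this
      exact ⟨_, this⟩
    have hev : f.coeff 0 + f.coeff 1 * s + f.coeff 2 * s^2 = (0:ℂ) := by
      rw [← hfs, aeval_eq_sum_range' (n := 3) (by omega)]
      simp [Finset.sum_range_succ]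
    have hre := congrArg Complex.re hev
    have him' := congrArg Complex.im hev
    simp [pow_two] at hre him'
    have hc2 : f.coeff 2 = 1 := by
      rcases Nat.lt_or_ge f.natDegree 2 with hlt | hge
      · exfalso
        have c2 : f.coeff 2 = 0 := coeff_eq_zero_of_natDegree_lt hlt
        simp [c2, him] at him'
        have hc0 : f.coeff 0 = 0 := by
          simp [c2, him'] at hre; exact hre
        rw [hc0] at hb
        norm_num at hb
      · have : f.natDegree = 2 := le_antisymm hcard hge
        rw [← this]; exact hmon
    rw [hc2] at hre him' hev
    have hA : (f.coeff 1 : ℝ) = -2 * s.re := by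
      apply mul_right_cancel₀ him
      push_cast at him'
      linear_combination him'
    have hB : (f.coeff 0 : ℝ) = s.re^2 + s.im^2 := by
      push_cast at hre
      rw [hA] at hre
      linear_combination hre
    have him2 : 0 < s.im^2 := by positivity
    have hB1 : f.coeff 0 = 1 := by
      rcases Int.isUnit_iff.mp (isUnit_of_dvd_one hb) with h | h
      · exact h
      · rw [h] at hB; push_cast at hB; nlinarith [sq_nonneg s.re]
    rw [hB1] at hB hev
    have hA1 : f.coeff 1 = -1 := by
      have u1 : (f.coeff 1 : ℝ) < 0 := by rw [hA]; linarith
      have u2 : (-2 : ℝ) < (f.coeff 1 : ℝ) := by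
        rw [hA]; push_cast at hB; nlinarith
      have v1 : f.coeff 1 < 0 := by exact_mod_cast u1
      have v2 : -2 < f.coeff 1 := by exact_mod_cast u2
      omega
    rw [hA1] at hev
    push_cast at hev
    obtain ⟨k, rfl⟩ := Nat.exists_eq_add_of_le hm4
    exact special_root s (by linear_combination hev) hpos k (by rw [show k+5 = 4+k+1 by omega]; exact hr)

lemma gluing_ind (z : ℕ → ℂ) (n : ℕ) (hn : 2 ≤ n) (h0 : ∀ i, 1 ≤ i → i ≤ n → z i ≠ 0)
    (h1 : 1 / z 2 = 1 - 1 / z 1 + 1 / z 1 ^ 2)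
    (hi : ∀ i, 1 ≤ i → i + 2 ≤ n → 1 / z (i+2) = 1 / z (i+1) + 1 - z i / z (i+1)) (s : ℂ) (hs : s = 1 - 1 / z 1) (G : ℕ → ℂ)
    (g0 : G 0 = 1) (g1 : G 1 = 1) (gg : ∀ k, G (k+2) = G k - s * G (k+1)) :
    ∀ j, j + 2 ≤ n → z (j+1) * G (j+2) = G j ∧ z (j+2) * G (j+3) = G (j+1) ∧ G j ≠ 0 ∧ G (j+1) ≠ 0 ∧
      G (j+2) ≠ 0 ∧ G (j+3) ≠ 0 := by
  intro j
  induction j with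
  | zero =>
    intro _
    have n1 := h0 1 le_rfl (by omega)
    have n2 := h0 2 (by omega) hn
    have e2 : G 2 = 1 / z 1 := by rw [gg 0, g0, g1, hs]; ring
    have e3 : G 3 = 1 / z 2 := by rw [gg 1, g1, e2, hs, h1]; ring
    simp only [zero_add]
    rw [g0, g1, e2, e3]
    refine ⟨by field_simp, by field_simp, one_ne_zero, one_ne_zero, by simpa using n1, by simpa using n2⟩
  | succ j ih =>
    intro hj
    obtain ⟨a1, a2, a3, a4, a5, a6⟩ := ih (by omega)
    have n3 := h0 (j+3) (by omega) (by omega)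
    have n2 := h0 (j+2) (by omega) (by omega)
    have e := hi (j+1) (by omega) (by omega)
    rw [show j+1+2 = j+3 from rfl, show j+1+1 = j+2 from rfl] at e ⊢
    rw [show j+1+3 = j+4 from rfl]
    have g4 := gg (j+2)
    have g2 := gg j
    have g3 := gg (j+1)
    have hz1 : z (j+1) = G j / G (j+2) := by field_simp; exact a1
    have hz2 : z (j+2) = G (j+1) / G (j+3) := by field_simp; exact a2
    have key : 1 / z (j+3) = G (j+4) / G (j+2) := by
      rw [e, hz1, hz2]
      field_simp
      rw [show j+2+2 = j+4 from rfl] at g4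
      rw [show j+1+2 = j+3 from rfl, show j+1+1=j+2 from rfl] at g3
      rw [show j+2+1=j+3 from rfl] at g4
      rw [g4]
      linear_combination (G (j+3)) * g2
    have fin : z (j+3) * G (j+4) = G (j+2) := by
      field_simp at key; linear_combination -key
    exact ⟨a2, fin, a4, a5, a6, fun h => a5 (by rw [← fin, h, mul_zero])⟩

theorem re_ne_one_of_gluing (p : ℕ) (hp : 2 ≤ p) (z : ℕ → ℂ)
    (hz : GluingSystem p z) :
    ∀ i : ℕ, 1 ≤ i → i ≤ 2 * p - 1 → (z i).re ≠ 1 := by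
  intro i hi1 hi2 hre
  obtain ⟨hnr, heq1, heq2, heq3⟩ := hz
  obtain ⟨q, rfl⟩ := Nat.exists_eq_add_of_le hp
  set n := 2 * (2 + q) - 1 with hn
  have hnq : n = 2 * q + 3 := by omega
  have h0 : ∀ i, 1 ≤ i → i ≤ n → z i ≠ 0 := fun i a b h => hnr i a b ⟨0, le_rfl, by simpa using h⟩
  have hne1 : ∀ i, 1 ≤ i → i ≤ n → 1 - z i ≠ 0 := fun i a b h => hnr i a b ⟨1, zero_le_one, by
    rw [Complex.ofReal_one]; linear_combination -h⟩
  have hcan : ∀ x y w : ℂ, x ≠ 0 → 1 - x ≠ 0 → (1 - x * y) * (1 - 1 / x) = (1 - x) * (1 - w / x) →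
      y = 1 / x + 1 - w / x := by
    intro x y w hx hx1 h
    field_simp at h ⊢
    apply mul_left_cancel₀ hx1
    linear_combination h
  have h1 : 1 / z 2 = 1 - 1 / z 1 + 1 / z 1 ^ 2 := by
    have a := h0 1 le_rfl (by omega)
    have b := h0 2 (by omega) (by omega)
    field_simp at heq1 ⊢
    linear_combination -heq1
  have hi : ∀ i, 1 ≤ i → i + 2 ≤ n → 1 / z (i+2) = 1 / z (i+1) + 1 - z i / z (i+1) := by
    intro i a b
    have := heq2 (i+1) (by omega) (by omega)
    rw [Nat.add_sub_cancel, show i+1+1 = i+2 from rfl] at this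
    apply hcan _ _ _ (h0 _ (by omega) (by omega)) (hne1 _ (by omega) (by omega))
    rw [← this]; ring
  set s : ℂ := 1 - 1 / z 1 with hs
  have hind := gluing_ind z n (by omega) h0 h1 hi s hs (fun k => aeval s (seqG k)) (by simp [seqG]) (by simp [seqG]) (aeval_G s)
  have hroot : aeval s (seqG (2*(2+q)+1)) = 0 := by
    have e : (0:ℂ) = 1 / z n + 1 - z (n-1) / z n := by
      apply hcan _ _ _ (h0 _ (by omega) le_rfl) (hne1 _ (by omega) le_rfl)
      rw [show n - 1 = 2 * (2+q) - 2 by omega, ← heq3]; ring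
    obtain ⟨a1, a2, a3, a4, a5, a6⟩ := hind (2*q+1) (by omega)
    have g4 := aeval_G s (2*q+3)
    have g2 := aeval_G s (2*q+1)
    rw [show n - 1 = 2*q+2 by omega, hnq] at e
    simp only [show 2*q+1+1 = 2*q+2 from rfl, show 2*q+1+2 = 2*q+3 from rfl, show 2*q+1+3 = 2*q+4 from rfl, show 2*q+3+1 = 2*q+4 from rfl, show 2*q+3+2 = 2*q+5 from rfl] at *
    have hz1 : z (2*q+2) = aeval s (seqG (2*q+1)) / aeval s (seqG (2*q+3)) := by field_simp; exact a1
    have hz2 : z (2*q+3) = aeval s (seqG (2*q+2)) / aeval s (seqG (2*q+4)) := by field_simp; exact a2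
    rw [hz1, hz2] at e
    field_simp at e
    rw [show 2*(2+q)+1 = 2*q+5 by omega, g4]
    apply mul_left_cancel₀ a4
    linear_combination -e - aeval s (seqG (2*q+4)) * g2
  have hzi : ∃ k, i = k + 1 ∧ z i * aeval s (seqG (k+2)) = aeval s (seqG k) ∧ aeval s (seqG (k+1)) ≠ 0 ∧ aeval s (seqG (k+2)) ≠ 0 := by
    rcases Nat.lt_or_ge i n with h | h
    · obtain ⟨a1, a2, a3, a4, a5, a6⟩ := hind (i-1) (by omega)
      refine ⟨i-1, by omega, ?_, a4, a5⟩
      rw [← a1]; congr 2; omega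
    · obtain ⟨a1, a2, a3, a4, a5, a6⟩ := hind (2*q+1) (by omega)
      refine ⟨2*q+2, by omega, ?_, a5, a6⟩
      rw [← a2]; congr 2; omega
  obtain ⟨k, hik, hzk, hk1, hk2⟩ := hzi
  have hgk := aeval_G s k
  have him : s.im ≠ 0 := by
    intro h
    have hsc : (starRingEnd ℂ) s = s := Complex.conj_eq_iff_im.mpr h
    have hG : ∀ g : ℤ[X], (starRingEnd ℂ) (aeval s g) = aeval s g := fun g => by
      rw [hom_aeval, hsc]
    have hzc : (starRingEnd ℂ) (z i) = z i := by
      apply mul_right_cancel₀ hk2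
      rw [hzk, ← hG (seqG k), ← hzk, map_mul, hG]
    apply hnr i hi1 hi2
    refine ⟨1, zero_le_one, ?_⟩
    rw [← hre]; exact (Complex.conj_eq_iff_re.mp hzc).symm
  apply main_arith (2*(2+q)) (even_two_mul _) (by omega) s him hroot (k+1) hk1 hk2
  rw [show k+1+1 = k+2 from rfl]
  have hsg : s * aeval s (seqG (k+1)) = (z i - 1) * aeval s (seqG (k+2)) := by
    linear_combination hgk - hzk
  rw [hsg, map_mul]
  have hw : (z i - 1) + (starRingEnd ℂ) (z i - 1) = 0 := by
    apply Complex.ext <;> simp [hre]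
  linear_combination aeval s (seqG (k+2)) * (starRingEnd ℂ) (aeval s (seqG (k+2))) * hw
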